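/- Let φ₀(ξ) = tanh(ξ/√2) and let φ₁ : ℝ → ℝ be twice continuously differentiable with φ₁, φ₁' and φ₁'' bounded on ℝ. Then the function ξ ↦ φ₁''(ξ)·φ₀'(ξ) − (3φ₀(ξ)² − 1)·φ₀'(ξ)·φ₁(ξ) is integrable on ℝ and ∫_{−∞}^{+∞} (φ₁''(ξ)·φ₀'(ξ) − (3φ₀(ξ)² − 1)·φ₀'(ξ)·φ₁(ξ)) dξ = 0. -/

import Mathlib

open MeasureTheory

theorem Real.one_sub_tanh_sq (x : ℝ) : 1 - Real.tanh x ^ 2 = (Real.cosh x ^ 2)⁻¹ := by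
  have hc := (Real.cosh_pos x).ne'
  rw [Real.tanh_eq_sinh_div_cosh]
  field_simp
  linarith [Real.cosh_sq x]

theorem Real.hasDerivAt_tanh_one_sub_sq (x : ℝ) :
    HasDerivAt Real.tanh (1 - Real.tanh x ^ 2) x := by
  have hc := (Real.cosh_pos x).ne'
  have h := (Real.hasDerivAt_sinh x).div (Real.hasDerivAt_cosh x) hc
  have he : Real.tanh = Real.sinh / Real.cosh := funext Real.tanh_eq_sinh_div_cosh
  rw [he]
  refine h.congr_deriv ?_
  rw [Pi.div_apply]
  field_simp

theorem Real.continuous_tanh : Continuous Real.tanh :=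
  continuous_iff_continuousAt.mpr fun x => (Real.hasDerivAt_tanh_one_sub_sq x).continuousAt

theorem Real.integrable_one_sub_tanh_sq : Integrable fun x : ℝ => 1 - Real.tanh x ^ 2 := by
  have hc := Real.continuous_tanh
  refine integrable_inv_one_add_sq.mono' (by fun_prop) (.of_forall fun x => ?_)
  rw [Real.one_sub_tanh_sq, Real.norm_of_nonneg (by positivity)]
  have h : x ^ 2 ≤ Real.sinh x ^ 2 := by
    rw [sq_le_sq, Real.abs_sinh]
    exact Real.self_le_sinh_iff.mpr (abs_nonneg x)
  gcongr
  linarith [Real.cosh_sq x]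

/-- A twofold integration by parts on the whole line: if `ψ` and `ψ'` are integrable and
`ψ'' = V ψ`, then `ψ` annihilates `u'' - V u` for every `u` bounded with its derivatives. -/
theorem integral_deriv_deriv_mul_sub_eq_zero {u ψ ψ' V : ℝ → ℝ} (hu : ContDiff ℝ 2 u)
    (hb : ∃ C, ∀ x, |u x| ≤ C) (hb' : ∃ C, ∀ x, |deriv u x| ≤ C)
    (hb'' : ∃ C, ∀ x, |deriv (deriv u) x| ≤ C)
    (hψ : ∀ x, HasDerivAt ψ (ψ' x) x) (hψ' : ∀ x, HasDerivAt ψ' (V x * ψ x) x)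
    (hψi : Integrable ψ) (hψi' : Integrable ψ') (hVψ : Integrable fun x => V x * ψ x) :
    Integrable (fun x => deriv (deriv u) x * ψ x - V x * ψ x * u x) ∧
      ∫ x, (deriv (deriv u) x * ψ x - V x * ψ x * u x) = 0 := by
  obtain ⟨C, hC⟩ := hb
  obtain ⟨C', hC'⟩ := hb'
  obtain ⟨C'', hC''⟩ := hb''
  have hu1 : ContDiff ℝ 1 (deriv u) :=
    (contDiff_succ_iff_deriv.mp (by exact_mod_cast hu : ContDiff ℝ (1 + 1) u)).2.2
  have hu2 : Continuous (deriv (deriv u)) := hu1.continuous_deriv le_rfl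
  have hint : Integrable fun x => deriv (deriv u) x * ψ x - V x * ψ x * u x :=
    (hψi.bdd_mul hu2.aestronglyMeasurable (.of_forall hC'')).sub
      (hVψ.mul_bdd hu.continuous.aestronglyMeasurable (.of_forall hC))
  refine ⟨hint, ?_⟩
  have hF : Integrable fun x => deriv u x * ψ x - u x * ψ' x :=
    (hψi.bdd_mul hu1.continuous.aestronglyMeasurable (.of_forall hC')).sub
      (hψi'.bdd_mul hu.continuous.aestronglyMeasurable (.of_forall hC))
  refine integral_eq_zero_of_hasDerivAt_of_integrable (fun x => ?_) hint hF
  have h0 := (hu.differentiable (by norm_num) x).hasDerivAt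
  have h1 := (hu1.differentiable (by norm_num) x).hasDerivAt
  refine ((h1.mul (hψ x)).sub (h0.mul (hψ' x))).congr_deriv ?_
  ring

/-- Integration-by-parts identity ((2.72)–(2.73) in Lemma 2.5): the corrector
`φ₁` contributes nothing, since `φ₀'` lies in the kernel of the linearized
Allen–Cahn operator `−∂_{ξξ} + (3φ₀² − 1)`. -/
theorem corrector_orthogonality
    (φ₀ : ℝ → ℝ) (hφ₀ : ∀ ξ : ℝ, φ₀ ξ = Real.tanh (ξ / Real.sqrt 2))
    (φ₁ : ℝ → ℝ) (hφ₁ : ContDiff ℝ 2 φ₁)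
    (hb : ∃ C : ℝ, ∀ ξ : ℝ, |φ₁ ξ| ≤ C)
    (hb' : ∃ C : ℝ, ∀ ξ : ℝ, |deriv φ₁ ξ| ≤ C)
    (hb'' : ∃ C : ℝ, ∀ ξ : ℝ, |deriv (deriv φ₁) ξ| ≤ C) :
    MeasureTheory.Integrable
      (fun ξ : ℝ => deriv (deriv φ₁) ξ * deriv φ₀ ξ
        - (3 * φ₀ ξ ^ 2 - 1) * deriv φ₀ ξ * φ₁ ξ) ∧
    ∫ ξ : ℝ, (deriv (deriv φ₁) ξ * deriv φ₀ ξ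
        - (3 * φ₀ ξ ^ 2 - 1) * deriv φ₀ ξ * φ₁ ξ) = 0 := by
  obtain rfl : φ₀ = fun ξ => Real.tanh (ξ / Real.sqrt 2) := funext hφ₀
  have hs : Real.sqrt 2 ≠ 0 := by positivity
  have hs2 : Real.sqrt 2 ^ 2 = 2 := Real.sq_sqrt (by norm_num)
  set φ : ℝ → ℝ := fun ξ => Real.tanh (ξ / Real.sqrt 2) with hφdef
  set ψ : ℝ → ℝ := fun ξ => (1 - φ ξ ^ 2) / Real.sqrt 2 with hψdef
  have hφ (x : ℝ) : HasDerivAt φ (ψ x) x := by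
    refine ((Real.hasDerivAt_tanh_one_sub_sq (x / Real.sqrt 2)).comp x
      ((hasDerivAt_id x).div_const (Real.sqrt 2))).congr_deriv ?_
    simp only [hψdef, hφdef]
    ring
  have hφc : Continuous φ := continuous_iff_continuousAt.mpr fun x => (hφ x).continuousAt
  have hφb (x : ℝ) : |φ x| ≤ 1 := (Real.abs_tanh_lt_one _).le
  have hψ (x : ℝ) : HasDerivAt ψ (-Real.sqrt 2 * φ x * ψ x) x := by
    refine ((((hφ x).pow 2).const_sub 1).div_const (Real.sqrt 2)).congr_deriv ?_
    rw [div_eq_iff hs]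
    push_cast
    linear_combination φ x * ψ x * hs2
  have hψ' (x : ℝ) :
      HasDerivAt (fun x => -Real.sqrt 2 * φ x * ψ x) ((3 * φ x ^ 2 - 1) * ψ x) x := by
    refine (((hφ x).const_mul (-Real.sqrt 2)).mul (hψ x)).congr_deriv ?_
    have h : Real.sqrt 2 * ψ x = 1 - φ x ^ 2 := mul_div_cancel₀ _ hs
    linear_combination φ x ^ 2 * ψ x * hs2 - ψ x * h
  have hψi : Integrable ψ := (Real.integrable_one_sub_tanh_sq.comp_div hs).div_const _
  have hderiv : deriv φ = ψ := funext fun x => (hφ x).deriv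
  rw [hderiv]
  refine integral_deriv_deriv_mul_sub_eq_zero hφ₁ hb hb' hb'' hψ hψ' hψi ?_ ?_
  · refine hψi.bdd_mul (c := Real.sqrt 2) (by fun_prop) (.of_forall fun x => ?_)
    rw [norm_mul, norm_neg, Real.norm_of_nonneg (Real.sqrt_nonneg 2)]
    exact mul_le_of_le_one_right (Real.sqrt_nonneg 2) (hφb x)
  · refine hψi.bdd_mul (c := 2) (by fun_prop) (.of_forall fun x => ?_)
    have h := (sq_le_one_iff_abs_le_one _).mpr (hφb x)
    rw [Real.norm_eq_abs, abs_le]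
    constructor <;> nlinarith [sq_nonneg (φ x)]
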